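/- For a conformal Courant algebroid datum over a commutative ℝ-algebra R satisfying the spanning condition, with Courant bracket [a,b]_C := (1/2)•([a,b] − [b,a]), one has for all a ∈ E and s ∈ L: [a, D s]_C = (1/2)•D(∇_a s) and [D s, a]_C = −(1/2)•D(∇_a s). (These are the compatibility relations l₂(a, l₁ s) = l₁(l₂(a,s)) of the Lie 2-algebra structure on the complex Γ(L) → Γ(E), where l₁(s) = D s and l₂(a,s) = (1/2)•∇_a s.) -/

import Mathlib

/-- A conformal Courant algebroid datum over a commutative ℝ-algebra `R`:
a Leibniz algebroid datum `(E, bk, anchor)` together with an `R`-module `L`,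
a symmetric nondegenerate `R`-bilinear pairing, an `E`-connection `conn` on `L`
and an additive map `D : L → E` with `pair a (D s) = conn a s`, satisfying the
conformal Courant axioms (CC1) and (CC2). -/
structure ConformalCourantData (R : Type) [CommRing R] [Algebra ℝ R]
    (E : Type) [AddCommGroup E] [Module ℝ E] [Module R E] [IsScalarTower ℝ R E]
    (L : Type) [AddCommGroup L] [Module ℝ L] [Module R L] [IsScalarTower ℝ R L] :
    Type where
  bk : E → E → E
  anchor : E → Derivation ℝ R R
  pair : E → E → L
  conn : E → L → L
  D : L → E
  bk_add_left : ∀ a b c : E, bk (a + b) c = bk a c + bk b c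
  bk_add_right : ∀ a b c : E, bk a (b + c) = bk a b + bk a c
  bk_smul_left : ∀ (r : ℝ) (a b : E), bk (r • a) b = r • bk a b
  bk_smul_right : ∀ (r : ℝ) (a b : E), bk a (r • b) = r • bk a b
  anchor_add : ∀ a b : E, anchor (a + b) = anchor a + anchor b
  leibniz1 : ∀ a b c : E, bk a (bk b c) = bk (bk a b) c + bk b (bk a c)
  leibniz2 : ∀ (a b : E) (f : R), bk a (f • b) = f • bk a b + (anchor a f) • b
  leibniz3 : ∀ a b : E, anchor (bk a b) = ⁅anchor a, anchor b⁆
  pair_symm : ∀ a b : E, pair a b = pair b a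
  pair_add_left : ∀ a b c : E, pair (a + b) c = pair a c + pair b c
  pair_smul_left : ∀ (f : R) (a b : E), pair (f • a) b = f • pair a b
  pair_nondeg : ∀ a : E, (∀ b : E, pair a b = 0) → a = 0
  conn_add_left : ∀ (a b : E) (s : L), conn (a + b) s = conn a s + conn b s
  conn_add_right : ∀ (a : E) (s t : L), conn a (s + t) = conn a s + conn a t
  conn_smul_left : ∀ (f : R) (a : E) (s : L), conn (f • a) s = f • conn a s
  conn_leibniz : ∀ (a : E) (f : R) (s : L),
    conn a (f • s) = (anchor a f) • s + f • conn a s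
  D_add : ∀ s t : L, D (s + t) = D s + D t
  pair_D : ∀ (a : E) (s : L), pair a (D s) = conn a s
  cc1 : ∀ a b c : E, conn a (pair b c) = pair (bk a b) c + pair b (bk a c)
  cc2 : ∀ a b : E, bk a b + bk b a = D (pair a b)

/-- The spanning condition: the `R`-submodule of `L` generated by all pairings
`⟨a,b⟩` is all of `L`. -/
def ConformalCourantData.Spanning {R : Type} [CommRing R] [Algebra ℝ R]
    {E : Type} [AddCommGroup E] [Module ℝ E] [Module R E] [IsScalarTower ℝ R E]
    {L : Type} [AddCommGroup L] [Module ℝ L] [Module R L] [IsScalarTower ℝ R L]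
    (dat : ConformalCourantData R E L) : Prop :=
  Submodule.span R {x : L | ∃ a b : E, x = dat.pair a b} = ⊤

/-- The (conformal) Courant bracket: the skew-symmetrization of the Dorfman bracket. -/
noncomputable def ConformalCourantData.cbk {R : Type} [CommRing R] [Algebra ℝ R]
    {E : Type} [AddCommGroup E] [Module ℝ E] [Module R E] [IsScalarTower ℝ R E]
    {L : Type} [AddCommGroup L] [Module ℝ L] [Module R L] [IsScalarTower ℝ R L]
    (dat : ConformalCourantData R E L) (a b : E) : E :=
  (1 / 2 : ℝ) • (dat.bk a b - dat.bk b a)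

namespace ConformalCourantData

variable {R : Type} [CommRing R] [Algebra ℝ R]
  {E : Type} [AddCommGroup E] [Module ℝ E] [Module R E] [IsScalarTower ℝ R E]
  {L : Type} [AddCommGroup L] [Module ℝ L] [Module R L] [IsScalarTower ℝ R L]

theorem bk_D_pair (dat : ConformalCourantData R E L) (a b c : E) :
    dat.bk (dat.D (dat.pair a b)) c = 0 := by
  rw [← dat.cc2, dat.bk_add_left]
  have h₁ := dat.leibniz1 a b c
  have h₂ := dat.leibniz1 b a c
  rw [h₂, ← add_assoc] at h₁
  exact left_eq_add.mp (h₁.trans (add_comm _ _))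

theorem bk_D (dat : ConformalCourantData R E L) (hspan : dat.Spanning) (s : L) (c : E) :
    dat.bk (dat.D s) c = 0 := by
  have key : ∀ f : R, dat.bk (dat.D (f • s)) c = 0 := by
    have hs : s ∈ Submodule.span R {x : L | ∃ a b : E, x = dat.pair a b} := by
      rw [hspan]
      trivial
    induction hs using Submodule.span_induction with
    | mem x hx =>
      obtain ⟨a, b, rfl⟩ := hx
      intro f
      rw [← dat.pair_smul_left]
      exact dat.bk_D_pair _ _ _
    | zero =>
      intro f
      have h := dat.D_add 0 0
      rw [add_zero, left_eq_add] at h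
      simpa [h] using dat.bk_smul_left 0 0 c
    | add x y _ _ hx hy =>
      intro f
      rw [smul_add, dat.D_add, dat.bk_add_left, hx, hy, add_zero]
    | smul g x _ hx =>
      intro f
      rw [smul_smul]
      exact hx _
  simpa using key 1

theorem bk_D_right (dat : ConformalCourantData R E L) (hspan : dat.Spanning) (a : E) (s : L) :
    dat.bk a (dat.D s) = dat.D (dat.conn a s) := by
  have h := dat.cc2 a (dat.D s)
  rwa [dat.bk_D hspan, add_zero, dat.pair_D] at h

end ConformalCourantData

/-- For a conformal Courant algebroid datum satisfying the spanning
condition: `[a, D s]_C = (1/2) • D(∇_a s)` and `[D s, a]_C = −(1/2) • D(∇_a s)`. -/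
theorem courant_bracket_D {R : Type} [CommRing R] [Algebra ℝ R]
    {E : Type} [AddCommGroup E] [Module ℝ E] [Module R E] [IsScalarTower ℝ R E]
    {L : Type} [AddCommGroup L] [Module ℝ L] [Module R L] [IsScalarTower ℝ R L]
    (dat : ConformalCourantData R E L) (hspan : dat.Spanning) :
    ∀ (a : E) (s : L),
      dat.cbk a (dat.D s) = (1 / 2 : ℝ) • dat.D (dat.conn a s) ∧
      dat.cbk (dat.D s) a = -((1 / 2 : ℝ) • dat.D (dat.conn a s)) := by
  intro a s
  simp only [ConformalCourantData.cbk, dat.bk_D hspan, dat.bk_D_right hspan, sub_zero, zero_sub,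
    smul_neg, and_self]
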